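/- Let G be a minimum counterexample to Hajós' conjecture containing two adjacent vertices u and v, each of degree 6, with |N(u) ∩ N(v)| = 5. Then the graph G − {u, v} obtained by deleting u and v does not contain a vertex having at least three neighbours in N(u) ∩ N(v). -/

import Mathlib

/-- A simple graph is Eulerian if it is connected and every vertex has even degree. -/
def IsEulerian {V : Type} [Fintype V] (G : SimpleGraph V) : Prop :=
  G.Connected ∧ ∀ v : V, Even ((G.neighborSet v).ncard)

/-- `G` fulfils Hajós' conjecture: its edge set can be partitioned into at most
`⌊(n-1)/2⌋` edge-disjoint cycles, where `n` is the number of vertices. -/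
def FulfilsHajos {V : Type} [Fintype V] (G : SimpleGraph V) : Prop :=
  ∃ (m : ℕ) (B : Fin m → V) (c : (i : Fin m) → G.Walk (B i) (B i)),
    m ≤ (Fintype.card V - 1) / 2 ∧
    (∀ i, (c i).IsCycle) ∧
    (∀ i j, i ≠ j → ∀ e, e ∈ (c i).edges → e ∉ (c j).edges) ∧
    (∀ e, e ∈ G.edgeSet ↔ ∃ i, e ∈ (c i).edges)

/-- A counterexample to Hajós' conjecture is an Eulerian graph not fulfilling it. -/
def IsCounterexample {V : Type} [Fintype V] (G : SimpleGraph V) : Prop :=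
  IsEulerian G ∧ ¬ FulfilsHajos G

/-- A minimum counterexample: a counterexample with the minimum number of edges among
all counterexamples having the minimum number of vertices. -/
def IsMinCounterexample {V : Type} [Fintype V] (G : SimpleGraph V) : Prop :=
  IsCounterexample G ∧
  (∀ (W : Type) [Fintype W] (H : SimpleGraph W),
      IsCounterexample H → Fintype.card V ≤ Fintype.card W) ∧
  (∀ (W : Type) [Fintype W] (H : SimpleGraph W),
      IsCounterexample H → Fintype.card W = Fintype.card V →
      G.edgeSet.ncard ≤ H.edgeSet.ncard)

/-- The multiset of edges of the path from `a` to `b` whose interior vertices are listed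
in order. -/
def segEdges {V : Type} : V → List V → V → Multiset (Sym2 V)
  | a, [], b => {s(a, b)}
  | a, c :: l, b => {s(a, c)} + segEdges c l b

/-- The edge multisets of cycles. -/
def IsCycleEdges {V : Type} (c : Multiset (Sym2 V)) : Prop :=
  ∃ (a : V) (l : List V), (a :: l).Nodup ∧ 2 ≤ l.length ∧ c = segEdges a l a

/-- The multiset `M` of edges is the sum of at most `k` cycles. -/
def CycleDecomposable {V : Type} (M : Multiset (Sym2 V)) (k : ℕ) : Prop :=
  ∃ D : Multiset (Multiset (Sym2 V)), (∀ c ∈ D, IsCycleEdges c) ∧ D.sum = M ∧ D.card ≤ k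

/-- All edges between the two adjacent vertices `u`, `v` and five common neighbours. -/
def hubEdges {V : Type} (u v x y z p q : V) : Multiset (Sym2 V) :=
  {s(u, v)} + {s(u, x)} + {s(u, y)} + {s(u, z)} + {s(u, p)} + {s(u, q)} +
    {s(v, x)} + {s(v, y)} + {s(v, z)} + {s(v, p)} + {s(v, q)}

section Segments

variable {V : Type}

@[simp] lemma segEdges_nil (a b : V) : segEdges a [] b = {s(a, b)} := rfl

@[simp] lemma segEdges_cons (a c b : V) (l : List V) :
    segEdges a (c :: l) b = {s(a, c)} + segEdges c l b := rfl

@[simp] lemma segEdges_append (a c b : V) (l m : List V) :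
    segEdges a (l ++ c :: m) b = segEdges a l c + segEdges c m b := by
  induction l generalizing a with
  | nil => simp
  | cons d l ih => simp [ih]

@[simp] lemma segEdges_reverse (a b : V) (l : List V) :
    segEdges a l.reverse b = segEdges b l a := by
  induction l generalizing b with
  | nil => simp [Sym2.eq_swap]
  | cons d l ih => simp [ih, add_comm, Sym2.eq_swap]

lemma isCycleEdges_segEdges {a : V} {l : List V} (h : (a :: l).Nodup) (hl : 2 ≤ l.length) :
    IsCycleEdges (segEdges a l a) := ⟨a, l, h, hl, rfl⟩

lemma CycleDecomposable.mono {M : Multiset (Sym2 V)} {k m : ℕ} (h : CycleDecomposable M k)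
    (hkm : k ≤ m) : CycleDecomposable M m := by
  obtain ⟨D, h₁, h₂, h₃⟩ := h
  exact ⟨D, h₁, h₂, h₃.trans hkm⟩

lemma CycleDecomposable.add {M N : Multiset (Sym2 V)} {k m : ℕ} (h : CycleDecomposable M k)
    (h' : CycleDecomposable N m) : CycleDecomposable (M + N) (k + m) := by
  obtain ⟨D, h₁, h₂, h₃⟩ := h
  obtain ⟨E, h₄, h₅, h₆⟩ := h'
  refine ⟨D + E, ?_, by simp [h₂, h₅], by simp; omega⟩
  intro c hc
  rcases Multiset.mem_add.1 hc with hc | hc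
  exacts [h₁ c hc, h₄ c hc]

lemma IsCycleEdges.cycleDecomposable {M : Multiset (Sym2 V)} (h : IsCycleEdges M) :
    CycleDecomposable M 1 := ⟨{M}, by simpa using h, by simp, by simp⟩

lemma cycleDecomposable_three {M a b c : Multiset (Sym2 V)} (ha : IsCycleEdges a)
    (hb : IsCycleEdges b) (hc : IsCycleEdges c) (h : M = a + b + c) : CycleDecomposable M 3 :=
  h ▸ (ha.cycleDecomposable.add hb.cycleDecomposable).add hc.cycleDecomposable

end Segments

section Reroutings

variable {V : Type}

set_option linter.unusedSimpArgs false

lemma reroute_of_not_mem {u v x y z p q : V} {P Q A : List V}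
    (hN : [u, v, x, y, z, p, q].Nodup)
    (h₁ : (x :: y :: P).Nodup) (h₂ : (y :: z :: Q).Nodup)
    (hA : A.Nodup) (hA' : ∀ a ∈ A, a ∉ [u, v, x, y, z, p, q])
    (hP : u ∉ P ∧ v ∉ P) (hp : p ∉ P) (hQ : u ∉ Q ∧ v ∉ Q) :
    CycleDecomposable (({s(x, y)} + segEdges y P x) + (segEdges y A z + segEdges z Q y) +
      hubEdges u v x y z p q) 3 := by
  have h : ∀ a b : V, s(a, b) = s(b, a) := fun _ _ => Sym2.eq_swap
  refine cycleDecomposable_three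
    (isCycleEdges_segEdges (a := x) (l := u :: p :: v :: y :: P) ?_ (by grind))
    (isCycleEdges_segEdges (a := y) (l := u :: v :: z :: Q) ?_ (by grind))
    (isCycleEdges_segEdges (a := x) (l := y :: (A ++ z :: u :: q :: v :: []))
      ?_ (by grind)) ?_
  · simp [List.nodup_append] at *; grind
  · simp [List.nodup_append] at *; grind
  · simp [List.nodup_append] at *; grind
  · simp only [hubEdges, segEdges_nil, segEdges_cons, segEdges_append, segEdges_reverse,
      h x u, h y u, h z u, h p u, h q u, h x v, h y v, h z v, h p v, h q v, h v u]
    abel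

lemma reroute_of_mem_of_not_mem {u v x y z p q : V} {P S R A Q : List V}
    (hN : [u, v, x, y, z, p, q].Nodup)
    (h₁ : (x :: y :: (P ++ p :: (S ++ q :: R))).Nodup)
    (hA : A.Nodup) (hA' : ∀ a ∈ A, a ∉ [u, v, x, y, z, p, q])
    (hP : u ∉ P ∧ v ∉ P) (hS : u ∉ S ∧ v ∉ S) (hz : z ∉ S) (h₂ : (y :: z :: Q).Nodup)
    (hQ : u ∉ Q ∧ v ∉ Q) (hR : u ∉ R ∧ v ∉ R)
    (hAS : ∀ a ∈ A, a ∉ S) :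
    CycleDecomposable (({s(x, y)} + segEdges y (P ++ p :: (S ++ q :: R)) x) +
      (segEdges y A z + segEdges z Q y) +
      hubEdges u v x y z p q) 3 := by
  have h : ∀ a b : V, s(a, b) = s(b, a) := fun _ _ => Sym2.eq_swap
  refine cycleDecomposable_three
    (isCycleEdges_segEdges (a := y) (l := (P ++ p :: v :: x :: (R.reverse ++ q :: u :: [])))
      ?_ (by grind))
    (isCycleEdges_segEdges (a := y) (l := v :: u :: z :: Q) ?_ (by grind))
    (isCycleEdges_segEdges (a := x) (l := y :: (A ++ z :: v :: q :: (S.reverse ++ p :: u :: [])))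
      ?_ (by grind)) ?_
  · simp [List.nodup_append] at *; grind
  · simp [List.nodup_append] at *; grind
  · simp [List.nodup_append] at *; grind
  · simp only [hubEdges, segEdges_nil, segEdges_cons, segEdges_append, segEdges_reverse,
      h x u, h y u, h z u, h p u, h q u, h x v, h y v, h z v, h p v, h q v, h v u]
    abel

lemma reroute_of_mem_of_mem {u v x y z p q : V} {P S R A Q : List V}
    (hN : [u, v, x, y, z, p, q].Nodup)
    (h₁ : (x :: y :: (P ++ p :: (S ++ z :: R))).Nodup) (h₂ : (y :: z :: Q).Nodup)
    (hA : A.Nodup) (hA' : ∀ a ∈ A, a ∉ [u, v, x, y, z, p, q])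
    (hP : u ∉ P ∧ v ∉ P) (hS : u ∉ S ∧ v ∉ S) (hq : q ∉ S) (hR : u ∉ R ∧ v ∉ R)
    (hQ : u ∉ Q ∧ v ∉ Q) (hAS : ∀ a ∈ A, a ∉ S) :
    CycleDecomposable (({s(x, y)} + segEdges y (P ++ p :: (S ++ z :: R)) x) +
      (segEdges y A z + segEdges z Q y) +
      hubEdges u v x y z p q) 3 := by
  have h : ∀ a b : V, s(a, b) = s(b, a) := fun _ _ => Sym2.eq_swap
  refine cycleDecomposable_three
    (isCycleEdges_segEdges (a := y) (l := (P ++ p :: u :: z :: (R ++ x :: v :: [])))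
      ?_ (by grind))
    (isCycleEdges_segEdges (a := y) (l := u :: v :: z :: Q) ?_ (by grind))
    (isCycleEdges_segEdges (a := x) (l := y :: (A ++ z :: (S.reverse ++ p :: v :: q :: u :: [])))
      ?_ (by grind)) ?_
  · simp [List.nodup_append] at *; grind
  · simp [List.nodup_append] at *; grind
  · simp [List.nodup_append] at *; grind
  · simp only [hubEdges, segEdges_nil, segEdges_cons, segEdges_append, segEdges_reverse,
      h x u, h y u, h z u, h p u, h q u, h x v, h y v, h z v, h p v, h q v, h v u]
    abel

lemma reroute_disjoint {u v x y z p q : V} {L Q : List V}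
    (hN : [u, v, x, y, z, p, q].Nodup)
    (h₁ : (x :: y :: L).Nodup) (h₂ : (z :: p :: Q).Nodup)
    (hL : u ∉ L ∧ v ∉ L) (hQ : u ∉ Q ∧ v ∉ Q) (hq : q ∉ Q) :
    CycleDecomposable (({s(x, y)} + segEdges y L x) + ({s(z, p)} + segEdges p Q z) +
      hubEdges u v x y z p q) 3 := by
  have h : ∀ a b : V, s(a, b) = s(b, a) := fun _ _ => Sym2.eq_swap
  refine cycleDecomposable_three
    (isCycleEdges_segEdges (a := x) (l := u :: v :: y :: L) ?_ (by grind))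
    (isCycleEdges_segEdges (a := z) (l := u :: q :: v :: p :: Q) ?_ (by grind))
    (isCycleEdges_segEdges (a := x) (l := y :: u :: p :: z :: v :: []) ?_ (by grind)) ?_
  · simp [List.nodup_append] at *; grind
  · simp [List.nodup_append] at *; grind
  · simp [List.nodup_append] at *; grind
  · simp only [hubEdges, segEdges_nil, segEdges_cons, segEdges_append, segEdges_reverse,
      h x u, h y u, h z u, h p u, h q u, h x v, h y v, h z v, h p v, h q v, h v u, h p z]
    abel

lemma reroute_arcs {u v x y z p q : V} {A B : List V}
    (hN : [u, v, x, y, z, p, q].Nodup)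
    (h₁ : (x :: (A ++ y :: B)).Nodup)
    (hA : u ∉ A ∧ v ∉ A) (hB : u ∉ B ∧ v ∉ B) (hz : z ∉ B) :
    CycleDecomposable ((segEdges x A y + segEdges y B x) +
      hubEdges u v x y z p q) 3 := by
  have h : ∀ a b : V, s(a, b) = s(b, a) := fun _ _ => Sym2.eq_swap
  refine cycleDecomposable_three
    (isCycleEdges_segEdges (a := x) (l := (A ++ y :: v :: u :: [])) ?_ (by grind))
    (isCycleEdges_segEdges (a := y) (l := (B ++ x :: v :: z :: u :: [])) ?_ (by grind))
    (isCycleEdges_segEdges (a := p) (l := u :: q :: v :: []) ?_ (by grind)) ?_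
  · simp [List.nodup_append] at *; grind
  · simp [List.nodup_append] at *; grind
  · simp [List.nodup_append] at *; grind
  · simp only [hubEdges, segEdges_nil, segEdges_cons, segEdges_append, segEdges_reverse,
      h x u, h y u, h z u, h p u, h q u, h x v, h y v, h z v, h p v, h q v, h v u]
    abel

lemma reroute_common {u v x y z p q w : V} {P Q : List V}
    (hN : [u, v, x, y, z, p, q].Nodup)
    (h₁ : (w :: x :: P).Nodup) (h₂ : (w :: y :: Q).Nodup)
    (hw : w ∉ [u, v, x, y, z, p, q]) (hP : u ∉ P ∧ v ∉ P) (hQ : u ∉ Q ∧ v ∉ Q)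
    (hy : y ∉ P) (hx : x ∉ Q) (hp : p ∉ P) :
    CycleDecomposable (({s(w, x)} + segEdges x P w) + ({s(w, y)} + segEdges y Q w) +
      hubEdges u v x y z p q) 3 := by
  have h : ∀ a b : V, s(a, b) = s(b, a) := fun _ _ => Sym2.eq_swap
  refine cycleDecomposable_three
    (isCycleEdges_segEdges (a := w) (l := y :: u :: p :: v :: x :: P) ?_ (by grind))
    (isCycleEdges_segEdges (a := w) (l := x :: u :: v :: y :: Q) ?_ (by grind))
    (isCycleEdges_segEdges (a := z) (l := u :: q :: v :: []) ?_ (by grind)) ?_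
  · simp [List.nodup_append] at *; grind
  · simp [List.nodup_append] at *; grind
  · simp [List.nodup_append] at *; grind
  · simp only [hubEdges, segEdges_nil, segEdges_cons, segEdges_append, segEdges_reverse,
      h x u, h y u, h z u, h p u, h q u, h x v, h y v, h z v, h p v, h q v, h v u, h w x, h w y]
    abel

lemma reroute_two {u v x y z p q : V} {P Q : List V}
    (hN : [u, v, x, y, z, p, q].Nodup)
    (h₁ : (x :: y :: z :: P).Nodup) (h₂ : (z :: x :: Q).Nodup)
    (hP : u ∉ P ∧ v ∉ P) (hQ : u ∉ Q ∧ v ∉ Q) :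
    CycleDecomposable (segEdges z P x + segEdges x Q z +
      hubEdges u v x y z p q) 3 := by
  have h : ∀ a b : V, s(a, b) = s(b, a) := fun _ _ => Sym2.eq_swap
  refine cycleDecomposable_three
    (isCycleEdges_segEdges (a := x) (l := u :: y :: v :: z :: P) ?_ (by grind))
    (isCycleEdges_segEdges (a := x) (l := v :: u :: z :: Q.reverse) ?_ (by grind))
    (isCycleEdges_segEdges (a := p) (l := u :: q :: v :: []) ?_ (by grind)) ?_
  · simp [List.nodup_append] at *; grind
  · simp [List.nodup_append] at *; grind
  · simp [List.nodup_append] at *; grind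
  · simp only [hubEdges, segEdges_nil, segEdges_cons, segEdges_append, segEdges_reverse,
      h x u, h y u, h z u, h p u, h q u, h x v, h y v, h z v, h p v, h q v, h v u]
    abel

lemma reroute_three {u v x y z p q : V} {P Q R : List V}
    (hN : [u, v, x, y, z, p, q].Nodup)
    (h₁ : (x :: y :: P).Nodup) (h₂ : (y :: z :: Q).Nodup) (h₃ : (z :: x :: R).Nodup)
    (hP : u ∉ P ∧ v ∉ P) (hQ : u ∉ Q ∧ v ∉ Q) (hR : u ∉ R ∧ v ∉ R) :
    CycleDecomposable (segEdges y P x + segEdges z Q y + segEdges x R z +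
      hubEdges u v x y z p q) 4 := by
  have h : ∀ a b : V, s(a, b) = s(b, a) := fun _ _ => Sym2.eq_swap
  have key := (cycleDecomposable_three
    (isCycleEdges_segEdges (a := x) (l := u :: v :: y :: P) ?_ (by grind))
    (isCycleEdges_segEdges (a := y) (l := u :: z :: Q) ?_ (by grind))
    (isCycleEdges_segEdges (a := z) (l := v :: x :: R) ?_ (by grind)) rfl).add
    (isCycleEdges_segEdges (a := p) (l := u :: q :: [v]) ?_ (by grind)).cycleDecomposable
  · convert key using 1
    simp only [hubEdges, segEdges_nil, segEdges_cons, segEdges_append, segEdges_reverse,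
      h x u, h y u, h z u, h p u, h q u, h x v, h y v, h z v, h p v, h q v, h v u]
    abel
  all_goals simp at *; grind

end Reroutings

section Cycles

variable {V : Type}

/-- The vertex `x` is incident to an edge of `c`. -/
def Touches (x : V) (c : Multiset (Sym2 V)) : Prop := ∃ e ∈ c, x ∈ e

@[simp] lemma touches_segEdges {x a b : V} {l : List V} :
    Touches x (segEdges a l b) ↔ x = a ∨ x ∈ l ∨ x = b := by
  induction l generalizing a with
  | nil => simp [Touches]
  | cons d l ih =>
    have := @ih d
    simp only [Touches] at this ⊢
    simp only [segEdges_cons, Multiset.mem_add, Multiset.mem_singleton, or_and_right, exists_or,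
      this]
    simp
    grind

@[simp] lemma touches_add {x : V} {c d : Multiset (Sym2 V)} :
    Touches x (c + d) ↔ Touches x c ∨ Touches x d := by
  simp [Touches, or_and_right, exists_or]

@[simp] lemma touches_singleton {x a b : V} :
    Touches x {s(a, b)} ↔ x = a ∨ x = b := by
  simp [Touches]

@[simp] lemma touches_cons {x a b : V} {c : Multiset (Sym2 V)} :
    Touches x (s(a, b) ::ₘ c) ↔ (x = a ∨ x = b) ∨ Touches x c := by
  rw [← Multiset.singleton_add, touches_add, touches_singleton]

lemma touches_left {x y : V} {c : Multiset (Sym2 V)} (h : s(x, y) ∈ c) : Touches x c :=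
  ⟨_, h, by simp⟩

lemma touches_right {x y : V} {c : Multiset (Sym2 V)} (h : s(x, y) ∈ c) : Touches y c :=
  ⟨_, h, by simp⟩

lemma IsCycleEdges.exists_rotate {c : Multiset (Sym2 V)} (hc : IsCycleEdges c) {x : V}
    (hx : Touches x c) : ∃ l, (x :: l).Nodup ∧ 2 ≤ l.length ∧ c = segEdges x l x := by
  obtain ⟨a, m, hm, hl, rfl⟩ := hc
  rw [touches_segEdges] at hx
  rcases eq_or_ne x a with rfl | hxa
  · exact ⟨m, hm, hl, rfl⟩
  · obtain ⟨s, t, rfl⟩ := List.append_of_mem (show x ∈ m by tauto)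
    refine ⟨t ++ a :: s, ?_, ?_, ?_⟩
    · simp [List.nodup_append] at *; grind
    · simp at *; omega
    · simp [add_comm]

lemma IsCycleEdges.exists_path {c : Multiset (Sym2 V)} (hc : IsCycleEdges c) {x y : V}
    (hxy : s(x, y) ∈ c) :
    ∃ l, (x :: y :: l).Nodup ∧ l ≠ [] ∧ c = {s(x, y)} + segEdges y l x := by
  obtain ⟨m, hm, hl, rfl⟩ := hc.exists_rotate (touches_left hxy)
  obtain ⟨b, l, rfl⟩ := List.exists_cons_of_length_pos (show 0 < m.length by omega)
  rcases eq_or_ne b y with rfl | hby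
  · exact ⟨l, hm, by rintro rfl; simp at hl, rfl⟩
  · obtain ⟨l', d, rfl⟩ := (List.eq_nil_or_concat l).resolve_left (by rintro rfl; simp at hl)
    rw [List.concat_eq_append] at *
    simp only [segEdges_cons, segEdges_append, segEdges_nil, Multiset.mem_add,
      Multiset.mem_singleton] at hxy
    have h₁ : d = y := by
      rcases hxy with h | h | h
      · simp at h hm; grind
      · have := touches_left h
        simp at this hm; grind
      · simp at h hm; grind
    subst h₁
    refine ⟨(b :: l').reverse, ?_, by simp, ?_⟩
    · simp [List.nodup_append] at *; grind
    · simp only [segEdges_cons, segEdges_append, segEdges_nil, segEdges_reverse,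
        Sym2.eq_swap (a := d) (b := x)]
      abel

lemma IsCycleEdges.exists_path_two {c : Multiset (Sym2 V)} (hc : IsCycleEdges c) {x y z : V}
    (hxy : s(x, y) ∈ c) (hyz : s(y, z) ∈ c) (hxz : x ≠ z) :
    ∃ l, (x :: y :: z :: l).Nodup ∧ c = {s(x, y)} + ({s(y, z)} + segEdges z l x) := by
  obtain ⟨m, hm, hl, rfl⟩ := hc.exists_path hxy
  obtain ⟨b, l, rfl⟩ := List.exists_cons_of_ne_nil hl
  simp only [segEdges_cons, Multiset.mem_add, Multiset.mem_singleton] at hyz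
  have : b = z := by
    rcases hyz with h | h | h
    · simp at h; grind
    · simp at h; grind
    · have := touches_left h
      simp at this hm; grind
  subst this
  exact ⟨l, hm, rfl⟩

lemma IsCycleEdges.eq_or_eq {c : Multiset (Sym2 V)} (hc : IsCycleEdges c) {y a b d : V}
    (ha : s(y, a) ∈ c) (hb : s(y, b) ∈ c) (hd : s(y, d) ∈ c) (hab : a ≠ b) : d = a ∨ d = b := by
  obtain ⟨l, hl, rfl⟩ := hc.exists_path_two (Sym2.eq_swap ▸ ha) hb hab
  simp only [Multiset.mem_add, Multiset.mem_singleton] at hd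
  rcases hd with h | h | h
  · simp at h; grind
  · simp at h; grind
  · have := touches_left h
    simp at this hl; grind

lemma IsCycleEdges.mem_of_closed {c : Multiset (Sym2 V)} (hc : IsCycleEdges c) {T : Finset V}
    (hT : ∀ a ∈ T, ∃ b ∈ T, ∃ d ∈ T, b ≠ d ∧ s(a, b) ∈ c ∧ s(a, d) ∈ c) {x y : V}
    (hxT : x ∈ T) (hx : Touches x c) (hy : Touches y c) : y ∈ T := by
  obtain ⟨l, hl, -, hc'⟩ := hc.exists_rotate hx
  have step : ∀ a ∈ T, ∀ b, s(a, b) ∈ c → b ∈ T := by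
    intro a ha b hab
    obtain ⟨b₁, h₁, b₂, h₂, hne, h₃, h₄⟩ := hT a ha
    rcases hc.eq_or_eq h₃ h₄ hab hne with rfl | rfl <;> assumption
  have key : ∀ (m : List V) (a : V), a ∈ T → (∀ e ∈ segEdges a m x, e ∈ c) → ∀ d ∈ m, d ∈ T := by
    intro m
    induction m with
    | nil => simp
    | cons b m ih =>
      intro a ha h d hd
      have hb := step a ha b (h _ (by simp))
      rcases List.mem_cons.1 hd with rfl | hd
      · exact hb
      · exact ih b hb (fun e he => h e (by simp [he])) d hd
  rw [hc', touches_segEdges] at hy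
  have := key l x hxT (by simp [← hc'])
  grind

lemma List.exists_first {p : V → Prop} {l : List V} (h : ∃ a ∈ l, p a) :
    ∃ s a t, l = s ++ a :: t ∧ p a ∧ ∀ b ∈ s, ¬ p b := by
  classical
  induction l with
  | nil => simp at h
  | cons b l ih =>
    by_cases hb : p b
    · exact ⟨[], b, l, rfl, hb, by simp⟩
    · obtain ⟨s, a, t, rfl, ha, hs⟩ := ih (by grind)
      exact ⟨b :: s, a, t, rfl, ha, by grind⟩

lemma IsCycleEdges.exists_arcs {c : Multiset (Sym2 V)} (hc : IsCycleEdges c) {p : V → Prop}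
    {y y' : V} (hy : Touches y c) (hy' : Touches y' c) (hne : y' ≠ y) (hp : p y') :
    ∃ A z Q, (y :: (A ++ z :: Q)).Nodup ∧ p z ∧ (∀ a ∈ A, ¬ p a) ∧
      c = segEdges y A z + segEdges z Q y := by
  obtain ⟨l, hl, -, rfl⟩ := hc.exists_rotate hy
  obtain ⟨A, z, Q, rfl, hz, hA⟩ := List.exists_first (p := p) (l := l)
    ⟨y', by simp at hy'; grind, hp⟩
  exact ⟨A, z, Q, hl, hz, hA, by simp⟩

end Cycles

section Hubs

variable {V : Type}

/-- The edges between the two adjacent vertices `u`, `v` and their common neighbours `N`. -/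
def hub (u v : V) (N : Finset V) : Multiset (Sym2 V) :=
  {s(u, v)} + N.val.map (fun x => s(u, x)) + N.val.map (fun x => s(v, x))

/-- `x, y, z, p, q` lists the vertices of `N`, none of which is `u` or `v`. -/
def IsListing (u v : V) (N : Finset V) (x y z p q : V) : Prop :=
  [u, v, x, y, z, p, q].Nodup ∧ ∀ a, a ∈ N ↔ a ∈ [x, y, z, p, q]

lemma IsListing.hub_eq {u v x y z p q : V} {N : Finset V} (h : IsListing u v N x y z p q) :
    hub u v N = hubEdges u v x y z p q := by
  have hN : N.val = ↑[x, y, z, p, q] := by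
    refine (Multiset.Nodup.ext N.nodup ?_).2 ?_
    · have := h.1
      simp at this ⊢
      grind
    · simpa using h.2
  rw [hub, hN, hubEdges]
  simp only [← Multiset.cons_coe,
    Multiset.coe_nil, ← Multiset.singleton_add, Multiset.map_add, Multiset.map_singleton,
    Multiset.map_zero]
  abel

lemma exists_isListing {u v x y z : V} {N : Finset V} (huv : u ≠ v) (hu : u ∉ N) (hv : v ∉ N)
    (hN : N.card = 5) (hx : x ∈ N) (hy : y ∈ N) (hz : z ∈ N) (hxy : x ≠ y) (hxz : x ≠ z)
    (hyz : y ≠ z) : ∃ p q, IsListing u v N x y z p q := by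
  classical
  have h : (((N.erase x).erase y).erase z).card = 2 := by
    rw [Finset.card_erase_of_mem, Finset.card_erase_of_mem, Finset.card_erase_of_mem, hN] <;>
      simp [*, Ne.symm]
  obtain ⟨p, q, hpq, h⟩ := Finset.card_eq_two.1 h
  have h' : ∀ a, (a ∈ N ∧ a ≠ x ∧ a ≠ y ∧ a ≠ z) ↔ a = p ∨ a = q := by
    intro a
    have : a ∈ ((N.erase x).erase y).erase z ↔ a ∈ ({p, q} : Finset V) := by rw [h]
    simp at this
    tauto
  have hp := (h' p).2 (Or.inl rfl)
  have hq := (h' q).2 (Or.inr rfl)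
  refine ⟨p, q, ?_, ?_⟩
  · simp; grind
  · intro a; have := h' a; simp; grind

lemma IsListing.swap {u v x y z p q : V} {N : Finset V} (h : IsListing u v N x y z p q) :
    IsListing u v N x y z q p := by
  refine ⟨?_, fun a => (h.2 a).trans ?_⟩
  · have := h.1
    simp at this ⊢; grind
  · simp; tauto

lemma cycleDecomposable_of_le {D : Multiset (Multiset (Sym2 V))} (hD : ∀ c ∈ D, IsCycleEdges c)
    {C : Multiset (Multiset (Sym2 V))} (hC : C ≤ D) {M : Multiset (Sym2 V)} {j : ℕ}
    (h : CycleDecomposable (C.sum + M) j) :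
    CycleDecomposable (D.sum + M) (D.card - C.card + j) := by
  obtain ⟨R, rfl⟩ := Multiset.le_iff_exists_add.1 hC
  have hR : CycleDecomposable R.sum R.card := ⟨R, fun c hc => hD c (by simp [hc]), rfl, le_rfl⟩
  have := hR.add h
  rw [Multiset.sum_add, Multiset.card_add, Nat.add_sub_cancel_left]
  convert this using 1
  abel

lemma cycleDecomposable_of_one {D : Multiset (Multiset (Sym2 V))} (hD : ∀ c ∈ D, IsCycleEdges c)
    {c : Multiset (Sym2 V)} (hc : c ∈ D) {M : Multiset (Sym2 V)}
    (h : CycleDecomposable (c + M) 3) : CycleDecomposable (D.sum + M) (D.card + 2) := by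
  have := cycleDecomposable_of_le hD (Multiset.singleton_le.2 hc) (M := M) (by simpa using h)
  have h1 := Multiset.card_pos_iff_exists_mem.2 ⟨c, hc⟩
  exact this.mono (by simp; omega)

lemma cycleDecomposable_of_two {D : Multiset (Multiset (Sym2 V))} (hD : ∀ c ∈ D, IsCycleEdges c)
    {c d : Multiset (Sym2 V)} (hc : c ∈ D) (hd : d ∈ D) (hcd : c ≠ d) {M : Multiset (Sym2 V)}
    (h : CycleDecomposable (c + d + M) 3) : CycleDecomposable (D.sum + M) (D.card + 1) := by
  have hle : c ::ₘ {d} ≤ D := by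
    obtain ⟨R, rfl⟩ := Multiset.exists_cons_of_mem hc
    simp only [Multiset.cons_le_cons_iff, Multiset.singleton_le]
    exact (Multiset.mem_cons.1 hd).resolve_left hcd.symm
  have := cycleDecomposable_of_le hD hle (M := M) (by simpa using h)
  have h1 := Multiset.card_le_card hle
  simp at h1
  exact this.mono (by simp; omega)

variable {u v : V} {N : Finset V} {D : Multiset (Multiset (Sym2 V))}

lemma cycleDecomposable_of_edge_of_arc (hD : ∀ c ∈ D, IsCycleEdges c)
    (hu : ∀ c ∈ D, ¬ Touches u c) (hv : ∀ c ∈ D, ¬ Touches v c) {x y z p q : V}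
    (hN : IsListing u v N x y z p q) {L A Q : List V}
    (h₁ : (x :: y :: L).Nodup) (h₂ : (y :: (A ++ z :: Q)).Nodup)
    (hc : {s(x, y)} + segEdges y L x ∈ D) (hd : segEdges y A z + segEdges z Q y ∈ D)
    (hcd : {s(x, y)} + segEdges y L x ≠ segEdges y A z + segEdges z Q y)
    (hAN : ∀ a ∈ A, a ∉ N) (hAL : ∀ a ∈ A, a ∉ L) :
    CycleDecomposable (D.sum + hub u v N) (D.card + 1) := by
  have hu₁ := hu _ hc
  have hu₂ := hu _ hd
  have hv₁ := hv _ hc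
  have hv₂ := hv _ hd
  simp only [touches_add, touches_segEdges, touches_singleton, not_or] at hu₁ hu₂ hv₁ hv₂
  have hA : A.Nodup := by simp [List.nodup_append] at h₂; tauto
  have h₂' : (y :: z :: Q).Nodup := by simp [List.nodup_append] at h₂ ⊢; tauto
  refine cycleDecomposable_of_two hD hc hd hcd ?_
  have hA' : ∀ p q, IsListing u v N x y z p q → ∀ a ∈ A, a ∉ [u, v, x, y, z, p, q] := by
    intro p q hN a ha h
    have := hAN a ha
    rw [hN.2] at this
    simp at h this
    rcases h with rfl | rfl | h <;> tauto
  have main : ∀ p q, IsListing u v N x y z p q → ∀ P S R, L = P ++ p :: (S ++ q :: R) →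
      CycleDecomposable ({s(x, y)} + segEdges y L x + (segEdges y A z + segEdges z Q y) +
        hub u v N) 3 := by
    rintro p q hN P S R rfl
    rw [hN.hub_eq]
    simp at hu₁ hv₁ hAL
    by_cases hz : z ∈ S
    · obtain ⟨S, S', rfl⟩ := List.append_of_mem hz
      have e : P ++ p :: (S ++ z :: S' ++ q :: R) = P ++ p :: (S ++ z :: (S' ++ q :: R)) := by simp
      simp at hu₁ hv₁ hAL
      rw [e] at h₁ ⊢
      refine reroute_of_mem_of_mem hN.1 h₁ h₂' hA (hA' _ _ hN) (by tauto) (by tauto) ?_ ?_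
        (by tauto) ?_
      · simp [List.nodup_append] at h₁; grind
      · simp; tauto
      · intro a ha; have := hAL a ha; tauto
    · refine reroute_of_mem_of_not_mem hN.1 h₁ hA (hA' _ _ hN) (by tauto) (by tauto) hz h₂'
        (by tauto)
        (by tauto) ?_
      intro a ha; have := hAL a ha; tauto
  by_cases hp : p ∈ L
  · by_cases hq : q ∈ L
    · obtain ⟨P, M, rfl⟩ := List.append_of_mem hp
      have hpq : q ≠ p := by have := hN.1; simp at this; tauto
      have : q ∈ P ∨ q ∈ M := by simp at hq; tauto
      rcases this with h | h
      · obtain ⟨P, P', rfl⟩ := List.append_of_mem h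
        exact main q p hN.swap P P' M (by simp)
      · obtain ⟨S, R, rfl⟩ := List.append_of_mem h
        exact main p q hN P S R rfl
    · rw [hN.swap.hub_eq]
      exact reroute_of_not_mem hN.swap.1 h₁ h₂' hA (hA' _ _ hN.swap) (by tauto) hq (by tauto)
  · rw [hN.hub_eq]
    exact reroute_of_not_mem hN.1 h₁ h₂' hA (hA' _ _ hN) (by tauto) hp (by tauto)

end Hubs

section Decompositions

variable {V : Type}

/-- A cycle decomposition avoiding `u` and `v` that cannot be extended over the edges of the hub
`u, v, N` at the cost of `j` further cycles. -/
structure IsStuck (u v : V) (N : Finset V) (D : Multiset (Multiset (Sym2 V))) (j : ℕ) : Prop where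
  ne : u ≠ v
  card : N.card = 5
  left_notMem : u ∉ N
  right_notMem : v ∉ N
  cycle : ∀ c ∈ D, IsCycleEdges c
  left_not_touches : ∀ c ∈ D, ¬ Touches u c
  right_not_touches : ∀ c ∈ D, ¬ Touches v c
  nodup : D.sum.Nodup
  stuck : ¬ CycleDecomposable (D.sum + hub u v N) (D.card + j)

lemma exists_mem_of_mem_sum {D : Multiset (Multiset (Sym2 V))} {e : Sym2 V} (h : e ∈ D.sum) :
    ∃ c ∈ D, e ∈ c :=
  Multiset.mem_join.1 h

namespace IsStuck

variable {u v : V} {N : Finset V} {D : Multiset (Multiset (Sym2 V))} {j : ℕ}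

lemma mono (h : IsStuck u v N D j) {i : ℕ} (hi : i ≤ j) : IsStuck u v N D i :=
  { h with stuck := fun H => h.stuck (H.mono (by omega)) }

lemma false_of_edge_of_arc (h : IsStuck u v N D 1) {x y z : V} {L A Q : List V}
    (hx : x ∈ N) (hy : y ∈ N) (hz : z ∈ N) (hxz : x ≠ z)
    (h₁ : (x :: y :: L).Nodup) (h₂ : (y :: (A ++ z :: Q)).Nodup)
    (hc : {s(x, y)} + segEdges y L x ∈ D) (hd : segEdges y A z + segEdges z Q y ∈ D)
    (hcd : {s(x, y)} + segEdges y L x ≠ segEdges y A z + segEdges z Q y)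
    (hAN : ∀ a ∈ A, a ∉ N) (hAL : ∀ a ∈ A, a ∉ L) : False := by
  obtain ⟨p, q, hN⟩ := exists_isListing h.ne h.left_notMem h.right_notMem h.card hx hy hz
    (by grind) hxz (by grind)
  exact h.stuck (cycleDecomposable_of_edge_of_arc h.cycle h.left_not_touches h.right_not_touches
    hN h₁ h₂ hc hd hcd hAN hAL)

lemma eq_of_edges (h : IsStuck u v N D 1) {x y z : V} (hx : x ∈ N) (hy : y ∈ N) (hz : z ∈ N)
    (hxz : x ≠ z) {c d : Multiset (Sym2 V)} (hc : c ∈ D) (hd : d ∈ D) (hxy : s(x, y) ∈ c)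
    (hyz : s(y, z) ∈ d) : c = d := by
  by_contra hcd
  obtain ⟨L, h₁, -, rfl⟩ := (h.cycle c hc).exists_path hxy
  obtain ⟨Q, h₂, -, rfl⟩ := (h.cycle d hd).exists_path hyz
  exact h.false_of_edge_of_arc (A := []) hx hy hz hxz h₁ h₂ hc hd hcd (by simp) (by simp)

lemma eq_or_eq (h : IsStuck u v N D 1) {y a b d : V} (hy : y ∈ N) (ha : a ∈ N) (hb : b ∈ N)
    (hd : d ∈ N) (hab : a ≠ b) (hya : s(y, a) ∈ D.sum) (hyb : s(y, b) ∈ D.sum)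
    (hyd : s(y, d) ∈ D.sum) : d = a ∨ d = b := by
  by_contra! hne
  obtain ⟨c₁, h₁, hya⟩ := exists_mem_of_mem_sum hya
  obtain ⟨c₂, h₂, hyb⟩ := exists_mem_of_mem_sum hyb
  obtain ⟨c₃, h₃, hyd⟩ := exists_mem_of_mem_sum hyd
  obtain rfl := h.eq_of_edges ha hy hb hab h₁ h₂ (Sym2.eq_swap ▸ hya) hyb
  obtain rfl := h.eq_of_edges hd hy hb hne.2 h₃ h₁ (Sym2.eq_swap ▸ hyd) hyb
  have := (h.cycle _ h₁).eq_or_eq hya hyb hyd hab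
  tauto

/-- The set `T` of vertices is the vertex set of the cycle `c`. -/
def Closed (T : Finset V) (c : Multiset (Sym2 V)) : Prop :=
  ∀ a ∈ T, ∃ b ∈ T, ∃ d ∈ T, b ≠ d ∧ s(a, b) ∈ c ∧ s(a, d) ∈ c

lemma eq_of_closed (h : IsStuck u v N D 1) {T : Finset V} (hT : T ⊆ N)
    {c c' : Multiset (Sym2 V)} (hcl : Closed T c) (hc : c ∈ D) (hc' : c' ∈ D) (hne : c' ≠ c)
    {y y' : V} (hyT : y ∈ T) (hy : Touches y c') (hy' : Touches y' c') (hy'N : y' ∈ N) :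
    y' = y := by
  by_contra hyy
  obtain ⟨A, z, Q, h₂, hz, hA, rfl⟩ := (h.cycle _ hc').exists_arcs (p := (· ∈ N)) hy hy' hyy hy'N
  obtain ⟨x, hxT, hxz, hyx⟩ : ∃ x ∈ T, x ≠ z ∧ s(x, y) ∈ c := by
    obtain ⟨b, hb, d, hd, hbd, h1, h2⟩ := hcl y hyT
    rw [Sym2.eq_swap] at h1 h2
    grind
  obtain ⟨L, h₁, -, rfl⟩ := (h.cycle c hc).exists_path hyx
  refine h.false_of_edge_of_arc (hT hxT) (hT hyT) hz hxz h₁ h₂ hc hc' hne.symm hA ?_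
  intro a ha haL
  exact hA a ha (hT ((h.cycle _ hc).mem_of_closed hcl hyT (touches_right hyx)
    (by rw [touches_add, touches_segEdges]; tauto)))

lemma false_of_common (h : IsStuck u v N D 1) {w x y : V} (hw : w ∉ N) (hx : x ∈ N) (hy : y ∈ N)
    (hxy : x ≠ y) (hwx : s(w, x) ∈ D.sum) (hwy : s(w, y) ∈ D.sum)
    (hN₁ : ∀ c ∈ D, s(w, x) ∈ c → ∀ a ∈ N, Touches a c → a = x)
    (hN₂ : ∀ c ∈ D, s(w, y) ∈ c → ∀ a ∈ N, Touches a c → a = y) : False := by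
  obtain ⟨c, hc, hwx⟩ := exists_mem_of_mem_sum hwx
  obtain ⟨d, hd, hwy⟩ := exists_mem_of_mem_sum hwy
  obtain ⟨z, hz, hzx, hzy⟩ : ∃ z ∈ N, z ≠ x ∧ z ≠ y := by
    classical
    have : 0 < ((N.erase x).erase y).card := by
      rw [Finset.card_erase_of_mem (by grind), Finset.card_erase_of_mem hx, h.card]
      omega
    obtain ⟨z, hz⟩ := Finset.card_pos.1 this
    exact ⟨z, by grind⟩
  obtain ⟨p, q, hN⟩ := exists_isListing h.ne h.left_notMem h.right_notMem h.card hx hy hz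
    hxy hzx.symm hzy.symm
  have hp : p ∈ N := (hN.2 p).2 (by simp)
  have hN1 := hN.1
  have hcd : c ≠ d := by
    rintro rfl
    exact hxy (hN₂ c hc hwy x hx (touches_right hwx))
  have hN₁ := hN₁ c hc hwx
  have hN₂ := hN₂ d hd hwy
  obtain ⟨P, h₁, -, rfl⟩ := (h.cycle c hc).exists_path hwx
  obtain ⟨Q, h₂, -, rfl⟩ := (h.cycle d hd).exists_path hwy
  have hu₁ := h.left_not_touches _ hc
  have hu₂ := h.left_not_touches _ hd
  have hv₁ := h.right_not_touches _ hc
  have hv₂ := h.right_not_touches _ hd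
  simp only [touches_add, touches_segEdges, touches_singleton, not_or] at hu₁ hu₂ hv₁ hv₂ hN₁ hN₂
  simp at hN1
  refine h.stuck (cycleDecomposable_of_two h.cycle hc hd hcd ?_)
  rw [hN.hub_eq]
  have hw' : w ∉ [u, v, x, y, z, p, q] := by
    have := hN.2 w
    simp at this ⊢
    grind
  refine reroute_common hN.1 h₁ h₂ hw' (by tauto) (by tauto) ?_ ?_ ?_
  · intro H; exact hxy (hN₁ y hy (by tauto)).symm
  · intro H; exact hxy (hN₂ x hx (by tauto))
  · intro H; have := hN₁ p hp (by tauto); grind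

lemma false_of_triangle (h : IsStuck u v N D 1) {x y z p q : V} (hN : IsListing u v N x y z p q)
    (hxy : s(x, y) ∈ D.sum) (hyz : s(y, z) ∈ D.sum) (hxz : s(x, z) ∈ D.sum)
    (hpq : s(p, q) ∈ D.sum) : False := by
  classical
  obtain ⟨c₁, h₁, hxy⟩ := exists_mem_of_mem_sum hxy
  obtain ⟨c₂, h₂, hyz⟩ := exists_mem_of_mem_sum hyz
  obtain ⟨c₃, h₃, hxz⟩ := exists_mem_of_mem_sum hxz
  obtain ⟨c, hc, hpq⟩ := exists_mem_of_mem_sum hpq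
  have hd := hN.1
  simp at hd
  have hx : x ∈ N := (hN.2 x).2 (by simp)
  have hy : y ∈ N := (hN.2 y).2 (by simp)
  have hz : z ∈ N := (hN.2 z).2 (by simp)
  have hp : p ∈ N := (hN.2 p).2 (by simp)
  obtain rfl := h.eq_of_edges hx hy hz (by tauto) h₁ h₂ hxy hyz
  obtain rfl := h.eq_of_edges hx hz hy (by tauto) h₃ h₁ hxz (Sym2.eq_swap ▸ hyz)
  have hcl : Closed {x, y, z} c₃ := by
    intro a ha
    have e := fun a b : V => Sym2.eq_swap (a := a) (b := b)
    simp only [Finset.mem_insert, Finset.mem_singleton] at ha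
    rcases ha with rfl | rfl | rfl
    · exact ⟨y, by simp, z, by simp, by tauto, hxy, hxz⟩
    · exact ⟨x, by simp, z, by simp, by tauto, e x a ▸ hxy, hyz⟩
    · exact ⟨y, by simp, x, by simp, by tauto, e y a ▸ hyz, e x a ▸ hxz⟩
  have hT : ({x, y, z} : Finset V) ⊆ N := by
    intro a; simp; grind
  have hne : c ≠ c₃ := by
    rintro rfl
    have := (h.cycle c hc).mem_of_closed hcl (x := x) (by simp) (touches_left hxy)
      (touches_left hpq)
    simp at this
    grind
  obtain ⟨Q, hQ, -, rfl⟩ := (h.cycle c hc).exists_path hpq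
  obtain ⟨L, hL, -, rfl⟩ := (h.cycle c₃ h₃).exists_path hxy
  have hzQ : z ∉ Q := by
    intro H
    have := h.eq_of_closed hT hcl h₃ hc hne (y := z) (y' := p) (by simp) (by simp [H]) (by simp) hp
    grind
  have hu₁ := h.left_not_touches _ hc
  have hu₂ := h.left_not_touches _ h₃
  have hv₁ := h.right_not_touches _ hc
  have hv₂ := h.right_not_touches _ h₃
  simp only [touches_add, touches_segEdges, touches_singleton, not_or] at hu₁ hu₂ hv₁ hv₂
  have hN' : IsListing u v N x y p q z := by
    refine ⟨?_, fun a => (hN.2 a).trans ?_⟩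
    · simp; grind
    · simp; tauto
  refine h.stuck (cycleDecomposable_of_two h.cycle h₃ hc hne.symm ?_)
  rw [hN'.hub_eq]
  exact reroute_disjoint hN'.1 hL hQ (by tauto) (by tauto) hzQ

lemma not_touches_of_two_neighbors (h : IsStuck u v N D 1)
    (hdeg : ∀ a ∈ N, ∃ b ∈ N, ∃ d ∈ N, b ≠ d ∧ s(a, b) ∈ D.sum ∧ s(a, d) ∈ D.sum)
    {w x : V} (hw : w ∉ N) (hx : x ∈ N) {c : Multiset (Sym2 V)} (hc : c ∈ D) (hwx : s(w, x) ∈ c)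
    {a : V} (ha : a ∈ N) (hac : Touches a c) : a = x := by
  classical
  obtain ⟨b, hb, -, -, -, hxb, -⟩ := hdeg x hx
  obtain ⟨d, hd, hxb⟩ := exists_mem_of_mem_sum hxb
  have hcl : Closed (N.filter fun y => ∃ b ∈ N, s(y, b) ∈ d) d := by
    intro y hy
    obtain ⟨hy, b, hb, hyb⟩ := Finset.mem_filter.1 hy
    have key : ∀ b' ∈ N, s(y, b') ∈ D.sum → s(y, b') ∈ d := by
      intro b' hb' hyb'
      obtain ⟨d', hd', hyb'⟩ := exists_mem_of_mem_sum hyb'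
      rcases eq_or_ne b b' with rfl | hne
      · exact hyb
      · rwa [h.eq_of_edges hb hy hb' hne hd hd' (Sym2.eq_swap ▸ hyb) hyb']
    obtain ⟨b₁, h₁, b₂, h₂, hne, h₃, h₄⟩ := hdeg y hy
    have h₃ := key b₁ h₁ h₃
    have h₄ := key b₂ h₂ h₄
    exact ⟨b₁, Finset.mem_filter.2 ⟨h₁, y, hy, Sym2.eq_swap ▸ h₃⟩, b₂,
      Finset.mem_filter.2 ⟨h₂, y, hy, Sym2.eq_swap ▸ h₄⟩, hne, h₃, h₄⟩
  have hxT : x ∈ N.filter fun y => ∃ b ∈ N, s(y, b) ∈ d := Finset.mem_filter.2 ⟨hx, b, hb, hxb⟩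
  refine h.eq_of_closed (Finset.filter_subset _ _) hcl hd hc ?_ hxT (touches_right hwx) hac ha
  rintro rfl
  exact hw (Finset.mem_of_mem_filter _
    ((h.cycle c hc).mem_of_closed hcl hxT (touches_right hwx) (touches_left hwx)))

lemma exists_independent (h : IsStuck u v N D 1) {w x y z : V} (hx : x ∈ N) (hy : y ∈ N)
    (hz : z ∈ N) (hxy : x ≠ y) (hxz : x ≠ z) (hyz : y ≠ z) (hwx : s(w, x) ∈ D.sum)
    (hwy : s(w, y) ∈ D.sum) (hwz : s(w, z) ∈ D.sum) :
    ∃ a ∈ N, ∃ b ∈ N, ∃ d ∈ N, a ≠ b ∧ a ≠ d ∧ b ≠ d ∧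
      s(a, b) ∉ D.sum ∧ s(b, d) ∉ D.sum ∧ s(a, d) ∉ D.sum := by
  classical
  by_contra! hind
  have hw : w ∉ N := by
    intro hw
    have := h.eq_or_eq hw hx hy hz hxy hwx hwy hwz
    grind
  by_cases hdeg : ∀ a ∈ N, ∃ b ∈ N, ∃ d ∈ N, b ≠ d ∧ s(a, b) ∈ D.sum ∧ s(a, d) ∈ D.sum
  · exact h.false_of_common hw hx hy hxy hwx hwy
      (fun c hc hwc a ha => h.not_touches_of_two_neighbors hdeg hw hx hc hwc ha)
      (fun c hc hwc a ha => h.not_touches_of_two_neighbors hdeg hw hy hc hwc ha)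
  · push Not at hdeg
    obtain ⟨a, ha, hdeg⟩ := hdeg
    have h₁ : ((N.erase a).filter fun b => s(a, b) ∈ D.sum).card ≤ 1 := by
      refine Finset.card_le_one.2 fun b hb d hd => ?_
      by_contra hbd
      simp only [Finset.mem_filter, Finset.mem_erase] at hb hd
      exact hdeg b hb.1.2 d hd.1.2 hbd hb.2 hd.2
    have h₂ := Finset.card_filter_add_card_filter_not (s := N.erase a) (fun b => s(a, b) ∈ D.sum)
    rw [Finset.card_erase_of_mem ha, h.card] at h₂
    obtain ⟨r, hr, s, hs, t, ht, hrs, hrt, hst⟩ := Finset.two_lt_card.1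
      (show 2 < ((N.erase a).filter fun b => s(a, b) ∉ D.sum).card by omega)
    simp only [Finset.mem_filter, Finset.mem_erase] at hr hs ht
    obtain ⟨⟨hra, hr⟩, har⟩ := hr
    obtain ⟨⟨hsa, hs⟩, has⟩ := hs
    obtain ⟨⟨hta, ht⟩, hat⟩ := ht
    have e := fun a b : V => Sym2.eq_swap (a := a) (b := b)
    have hrs' : s(r, s) ∈ D.sum := by
      by_contra H
      exact has (hind a ha r hr s hs (Ne.symm hra) (Ne.symm hsa) hrs har H)
    have hst' : s(s, t) ∈ D.sum := by
      by_contra H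
      exact hat (hind a ha s hs t ht (Ne.symm hsa) (Ne.symm hta) hst has H)
    have hrt' : s(r, t) ∈ D.sum := by
      by_contra H
      exact hat (hind a ha r hr t ht (Ne.symm hra) (Ne.symm hta) hrt har H)
    obtain ⟨p, q, hN⟩ := exists_isListing h.ne h.left_notMem h.right_notMem h.card hr hs ht
      hrs hrt hst
    have hd := hN.1
    have hp : p ∈ N := (hN.2 p).2 (by simp)
    have hq : q ∈ N := (hN.2 q).2 (by simp)
    simp at hd
    refine h.false_of_triangle hN hrs' hst' hrt' ?_
    have deg : ∀ b ∈ N, b ≠ r → b ≠ s → b ≠ t → s(r, b) ∉ D.sum := by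
      intro b hb hbr hbs hbt H
      have := h.eq_or_eq hr hs ht hb hst hrs' hrt' H
      tauto
    by_contra H
    exact deg q hq (by grind) (by grind) (by grind) (
      hind r hr p hp q hq (by grind) (by grind) (by grind)
        (deg p hp (by grind) (by grind) (by grind)) H)

lemma false_of_two_touches (h : IsStuck u v N D 2) {c : Multiset (Sym2 V)} (hc : c ∈ D) {x y : V}
    (hx : x ∈ N) (hy : y ∈ N) (hxc : Touches x c) (hyc : Touches y c) (hxy : y ≠ x) : False := by
  classical
  obtain ⟨A, y, B, h₁, hy, -, rfl⟩ := (h.cycle c hc).exists_arcs (p := (· ∈ N)) hxc hyc hxy hy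
  have hxy : x ≠ y := by simp at h₁; tauto
  obtain ⟨z, hz, hzx, hzy⟩ : ∃ z ∈ N, z ≠ x ∧ z ≠ y := by
    have : 0 < ((N.erase x).erase y).card := by
      rw [Finset.card_erase_of_mem (by grind), Finset.card_erase_of_mem hx, h.card]
      omega
    obtain ⟨z, hz⟩ := Finset.card_pos.1 this
    exact ⟨z, by grind⟩
  have hu₁ := h.left_not_touches _ hc
  have hv₁ := h.right_not_touches _ hc
  simp only [touches_add, touches_segEdges, not_or] at hu₁ hv₁
  refine h.stuck (cycleDecomposable_of_one h.cycle hc ?_)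
  by_cases hzB : z ∈ B
  · obtain ⟨p, q, hN⟩ := exists_isListing h.ne h.left_notMem h.right_notMem h.card hy hx hz
      hxy.symm hzy.symm hzx.symm
    rw [hN.hub_eq, add_comm (segEdges x A y)]
    refine reroute_arcs hN.1 ?_ (by tauto) (by tauto) ?_
    · simp [List.nodup_append] at *; grind
    · simp [List.nodup_append] at *; grind
  · obtain ⟨p, q, hN⟩ := exists_isListing h.ne h.left_notMem h.right_notMem h.card hx hy hz
      hxy hzx.symm hzy.symm
    rw [hN.hub_eq]
    exact reroute_arcs hN.1 h₁ (by tauto) (by tauto) hzB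

lemma false_of_two_neighbors (h : IsStuck u v N D 2) {w x y : V} (hx : x ∈ N) (hy : y ∈ N)
    (hxy : x ≠ y) (hwx : s(w, x) ∈ D.sum) (hwy : s(w, y) ∈ D.sum) (hxw : x ≠ w) : False := by
  have key : ∀ c ∈ D, ∀ a ∈ N, ∀ b ∈ N, Touches a c → Touches b c → a = b := by
    intro c hc a ha b hb hac hbc
    by_contra hab
    exact h.false_of_two_touches hc hb ha hbc hac hab
  refine (h.mono one_le_two).false_of_common ?_ hx hy hxy hwx hwy
    (fun c hc hwc a ha hac => key c hc a ha x hx hac (touches_right hwc))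
    (fun c hc hwc a ha hac => key c hc a ha y hy hac (touches_right hwc))
  intro hw
  obtain ⟨c, hc, hwx⟩ := exists_mem_of_mem_sum hwx
  exact hxw (key c hc x hx w hw (touches_right hwx) (touches_left hwx))

end IsStuck
end Decompositions

section Triangles

variable {V : Type}

lemma IsListing.rotate {u v x y z p q : V} {N : Finset V} (h : IsListing u v N x y z p q) :
    IsListing u v N z x y p q := by
  refine ⟨?_, fun a => (h.2 a).trans ?_⟩
  · have := h.1
    simp at this ⊢; grind
  · simp; tauto

lemma cycleDecomposable_of_le_of_sum_eq {D : Multiset (Multiset (Sym2 V))} (hD : ∀ c ∈ D, IsCycleEdges c)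
    {C : Multiset (Multiset (Sym2 V))} (hC : C ≤ D) {E T M K : Multiset (Sym2 V)}
    (hsum : D.sum = T + E) (hCM : C.sum = T + M) {j : ℕ} (h : CycleDecomposable (M + K) j) :
    CycleDecomposable (E + K) (D.card - C.card + j) := by
  obtain ⟨R, rfl⟩ := Multiset.le_iff_exists_add.1 hC
  have hE : E = M + R.sum := by
    rw [Multiset.sum_add, hCM, add_assoc] at hsum
    exact (add_left_cancel hsum).symm
  have hR : CycleDecomposable R.sum R.card := ⟨R, fun c hc => hD c (by simp [hc]), rfl, le_rfl⟩
  rw [Multiset.card_add, Nat.add_sub_cancel_left, hE]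
  convert hR.add h using 1
  abel

variable {u v : V} {N : Finset V} {D : Multiset (Multiset (Sym2 V))}

lemma pair_le {c d : Multiset (Sym2 V)} (hc : c ∈ D) (hd : d ∈ D) (hcd : c ≠ d) :
    c ::ₘ {d} ≤ D := by
  obtain ⟨R, rfl⟩ := Multiset.exists_cons_of_mem hc
  simp only [Multiset.cons_le_cons_iff, Multiset.singleton_le]
  exact (Multiset.mem_cons.1 hd).resolve_left hcd.symm

lemma cycleDecomposable_of_path_of_edge (hD : ∀ c ∈ D, IsCycleEdges c)
    (hu : ∀ c ∈ D, ¬ Touches u c) (hv : ∀ c ∈ D, ¬ Touches v c) {x y z p q : V}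
    (hN : IsListing u v N x y z p q) {E : Multiset (Sym2 V)}
    (hsum : D.sum = {s(x, y)} + {s(y, z)} + {s(z, x)} + E) {c d : Multiset (Sym2 V)}
    (hc : c ∈ D) (hd : d ∈ D) (hcd : c ≠ d) (hxy : s(x, y) ∈ c) (hyz : s(y, z) ∈ c)
    (hzx : s(z, x) ∈ d) : CycleDecomposable (E + hub u v N) (D.card + 1) := by
  have hN1 := hN.1
  simp at hN1
  obtain ⟨P, h₁, rfl⟩ := (hD c hc).exists_path_two hxy hyz (by tauto)
  obtain ⟨Q, h₂, -, rfl⟩ := (hD d hd).exists_path hzx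
  have hu₁ := hu _ hc
  have hu₂ := hu _ hd
  have hv₁ := hv _ hc
  have hv₂ := hv _ hd
  simp only [touches_add, touches_segEdges, touches_singleton, not_or] at hu₁ hu₂ hv₁ hv₂
  have hle := pair_le hc hd hcd
  have := cycleDecomposable_of_le_of_sum_eq hD hle hsum (M := segEdges z P x + segEdges x Q z) (K := hub u v N) (j := 3)
    (by simp only [Multiset.sum_cons, Multiset.sum_singleton]; abel)
    (by
      rw [hN.hub_eq]
      exact reroute_two hN.1 h₁ h₂ (by tauto) (by tauto))
  have h1 := Multiset.card_le_card hle
  simp at h1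
  exact this.mono (by simp; omega)

lemma cycleDecomposable_of_three_edges (hD : ∀ c ∈ D, IsCycleEdges c)
    (hu : ∀ c ∈ D, ¬ Touches u c) (hv : ∀ c ∈ D, ¬ Touches v c) {x y z p q : V}
    (hN : IsListing u v N x y z p q) {E : Multiset (Sym2 V)}
    (hsum : D.sum = {s(x, y)} + {s(y, z)} + {s(z, x)} + E) {c d e : Multiset (Sym2 V)}
    (hc : c ∈ D) (hd : d ∈ D) (he : e ∈ D) (hcd : c ≠ d) (hce : c ≠ e) (hde : d ≠ e)
    (hxy : s(x, y) ∈ c) (hyz : s(y, z) ∈ d) (hzx : s(z, x) ∈ e) :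
    CycleDecomposable (E + hub u v N) (D.card + 1) := by
  have hle : c ::ₘ d ::ₘ {e} ≤ D := by
    obtain ⟨R, rfl⟩ := Multiset.exists_cons_of_mem hc
    rw [Multiset.cons_le_cons_iff]
    exact pair_le ((Multiset.mem_cons.1 hd).resolve_left hcd.symm)
      ((Multiset.mem_cons.1 he).resolve_left hce.symm) hde
  obtain ⟨P, h₁, -, rfl⟩ := (hD c hc).exists_path hxy
  obtain ⟨Q, h₂, -, rfl⟩ := (hD d hd).exists_path hyz
  obtain ⟨R, h₃, -, rfl⟩ := (hD e he).exists_path hzx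
  have hu₁ := hu _ hc
  have hu₂ := hu _ hd
  have hu₃ := hu _ he
  have hv₁ := hv _ hc
  have hv₂ := hv _ hd
  have hv₃ := hv _ he
  simp only [touches_add, touches_segEdges, touches_singleton, not_or]
    at hu₁ hu₂ hv₁ hv₂ hu₃ hv₃
  have := cycleDecomposable_of_le_of_sum_eq hD hle hsum (M := segEdges y P x + segEdges z Q y + segEdges x R z)
    (K := hub u v N) (j := 4)
    (by simp only [Multiset.sum_cons, Multiset.sum_singleton]; abel)
    (by
      rw [hN.hub_eq]
      exact reroute_three hN.1 h₁ h₂ h₃ (by tauto) (by tauto) (by tauto))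
  have h1 := Multiset.card_le_card hle
  simp at h1
  exact this.mono (by simp; omega)

lemma exists_of_triangle (hD : ∀ c ∈ D, IsCycleEdges c) {x y z : V} (hxz : x ≠ z)
    {E : Multiset (Sym2 V)} (hsum : D.sum = {s(x, y)} + {s(y, z)} + {s(z, x)} + E)
    {c : Multiset (Sym2 V)} (hc : c ∈ D) (hxy : s(x, y) ∈ c) (hyz : s(y, z) ∈ c)
    (hzx : s(z, x) ∈ c) :
    ∃ R : Multiset (Multiset (Sym2 V)), (∀ c ∈ R, IsCycleEdges c) ∧ R.sum = E ∧
      R.card + 1 = D.card := by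
  obtain ⟨R, rfl⟩ := Multiset.exists_cons_of_mem hc
  refine ⟨R, fun c hc => hD c (by simp [hc]), ?_, by simp⟩
  obtain ⟨l, hl, rfl⟩ := (hD c hc).exists_path_two hxy hyz hxz
  have : l = [] := by
    by_contra hne
    obtain ⟨b, l, rfl⟩ := List.exists_cons_of_ne_nil hne
    simp only [segEdges_cons, Multiset.mem_add, Multiset.mem_singleton] at hzx
    rcases hzx with h | h | h | h
    · simp at h hl; grind
    · simp at h hl; grind
    · simp at h hl; grind
    · have := touches_left h
      simp at this hl; grind
  subst this
  simp only [Multiset.sum_cons, segEdges_nil, ← add_assoc] at hsum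
  exact add_left_cancel hsum

lemma cycleDecomposable_or_exists (hD : ∀ c ∈ D, IsCycleEdges c)
    (hu : ∀ c ∈ D, ¬ Touches u c) (hv : ∀ c ∈ D, ¬ Touches v c) {x y z p q : V}
    (hN : IsListing u v N x y z p q) {E : Multiset (Sym2 V)}
    (hsum : D.sum = {s(x, y)} + {s(y, z)} + {s(z, x)} + E) :
    CycleDecomposable (E + hub u v N) (D.card + 1) ∨
      ∃ R : Multiset (Multiset (Sym2 V)), (∀ c ∈ R, IsCycleEdges c) ∧ R.sum = E ∧
        R.card + 1 = D.card := by
  obtain ⟨c, hc, hxy⟩ := exists_mem_of_mem_sum (D := D) (e := s(x, y)) (by rw [hsum]; simp)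
  obtain ⟨d, hd, hyz⟩ := exists_mem_of_mem_sum (D := D) (e := s(y, z)) (by rw [hsum]; simp)
  obtain ⟨e, he, hzx⟩ := exists_mem_of_mem_sum (D := D) (e := s(z, x)) (by rw [hsum]; simp)
  have hN1 := hN.1
  simp at hN1
  rcases eq_or_ne c d with rfl | hcd
  · rcases eq_or_ne c e with rfl | hce
    · exact Or.inr (exists_of_triangle hD (by tauto) hsum hc hxy hyz hzx)
    · exact Or.inl (cycleDecomposable_of_path_of_edge hD hu hv hN hsum hc he hce hxy hyz hzx)
  · rcases eq_or_ne c e with rfl | hce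
    · refine Or.inl (cycleDecomposable_of_path_of_edge hD hu hv
        hN.rotate (hsum.trans ?_) hc hd hcd hzx hxy hyz)
      abel
    · rcases eq_or_ne d e with rfl | hde
      · refine Or.inl (cycleDecomposable_of_path_of_edge hD hu hv
          hN.rotate.rotate (hsum.trans ?_) hd hc hcd.symm hyz hzx hxy)
        abel
      · exact Or.inl (cycleDecomposable_of_three_edges hD hu hv hN hsum hc hd he hcd hce hde
          hxy hyz hzx)

end Triangles

section Core

variable {V : Type}

lemma not_touches_of_mem {D : Multiset (Multiset (Sym2 V))} {x : V} (h : ¬ Touches x D.sum) :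
    ∀ c ∈ D, ¬ Touches x c := by
  rintro c hc ⟨e, he, hx⟩
  exact h ⟨e, Multiset.mem_join.2 ⟨c, hc, he⟩, hx⟩

lemma cycleDecomposable_add_hub {u v : V} {N : Finset V} {E : Multiset (Sym2 V)} {k : ℕ}
    (huv : u ≠ v) (hcard : N.card = 5) (huN : u ∉ N) (hvN : v ∉ N) (hE : E.Nodup)
    (hu : ¬ Touches u E) (hv : ¬ Touches v E) (h₁ : CycleDecomposable E k)
    (h₂ : ∀ x ∈ N, ∀ y ∈ N, ∀ z ∈ N, x ≠ y → x ≠ z → y ≠ z →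
      s(x, y) ∉ E → s(y, z) ∉ E → s(x, z) ∉ E →
      CycleDecomposable ({s(x, y)} + {s(y, z)} + {s(z, x)} + E) k)
    {w x y z : V} (hx : x ∈ N) (hy : y ∈ N) (hz : z ∈ N) (hxy : x ≠ y) (hxz : x ≠ z)
    (hyz : y ≠ z) (hxw : x ≠ w) (hwx : s(w, x) ∈ E) (hwy : s(w, y) ∈ E) (hwz : s(w, z) ∈ E) :
    CycleDecomposable (E + hub u v N) (k + 1) := by
  by_contra hbad
  obtain ⟨D, hD, rfl, hDk⟩ := h₁
  have hS : IsStuck u v N D 1 := ⟨huv, hcard, huN, hvN, hD, not_touches_of_mem hu,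
    not_touches_of_mem hv, hE, fun H => hbad (H.mono (by omega))⟩
  obtain ⟨a, ha, b, hb, d, hd, hab, had, hbd, h₃, h₄, h₅⟩ :=
    hS.exists_independent hx hy hz hxy hxz hyz hwx hwy hwz
  obtain ⟨D', hD', hsum, hDk'⟩ := h₂ a ha b hb d hd hab had hbd h₃ h₄ h₅
  obtain ⟨p, q, hN⟩ := exists_isListing huv huN hvN hcard ha hb hd hab had hbd
  have hu' : ¬ Touches u D'.sum := by
    rw [hsum]
    simp only [touches_add, touches_singleton]
    grind
  have hv' : ¬ Touches v D'.sum := by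
    rw [hsum]
    simp only [touches_add, touches_singleton]
    grind
  rcases cycleDecomposable_or_exists hD' (not_touches_of_mem hu') (not_touches_of_mem hv') hN hsum
    with h | ⟨R, hR, hRs, hRk⟩
  · exact hbad (h.mono (by omega))
  · have hS : IsStuck u v N R 2 := ⟨huv, hcard, huN, hvN, hR, not_touches_of_mem (hRs ▸ hu),
      not_touches_of_mem (hRs ▸ hv), hRs ▸ hE, fun H => hbad (hRs ▸ H.mono (by omega))⟩
    exact hS.false_of_two_neighbors hx hy hxy (hRs ▸ hwx) (hRs ▸ hwy) hxw

end Core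

section Walks

variable {V : Type} {G : SimpleGraph V}

lemma exists_edges_eq_segEdges {a b : V} (p : G.Walk a b) (hp : ¬ p.Nil) :
    ∃ l, p.support = a :: (l ++ [b]) ∧ (p.edges : Multiset (Sym2 V)) = segEdges a l b := by
  induction p with
  | nil => simp at hp
  | @cons a c b h q ih =>
    by_cases hq : q.Nil
    · obtain rfl := hq.eq
      obtain rfl := SimpleGraph.Walk.eq_nil_iff_nil.2 hq
      exact ⟨[], by simp, by simp⟩
    · obtain ⟨l, h₁, h₂⟩ := ih hq
      exact ⟨c :: l, by simp [h₁], by simp [← h₂]⟩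

lemma isCycleEdges_of_isCycle {a : V} {p : G.Walk a a} (hp : p.IsCycle) :
    IsCycleEdges (p.edges : Multiset (Sym2 V)) := by
  obtain ⟨l, h₁, h₂⟩ := exists_edges_eq_segEdges p hp.not_nil
  refine ⟨a, l, ?_, ?_, h₂⟩
  · have := hp.support_nodup
    rw [h₁] at this
    simp [List.nodup_append] at this ⊢
    grind
  · have h3 := hp.three_le_length
    have := p.length_support
    rw [h₁] at this
    simp at this
    omega

lemma exists_walk_of_segEdges {a b : V} {l : List V}
    (h : ∀ e ∈ segEdges a l b, e ∈ G.edgeSet) :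
    ∃ p : G.Walk a b, p.support = a :: (l ++ [b]) ∧
      (p.edges : Multiset (Sym2 V)) = segEdges a l b := by
  induction l generalizing a with
  | nil =>
    have hab : G.Adj a b := (SimpleGraph.mem_edgeSet G).1 (h s(a, b) (by simp))
    exact ⟨.cons hab .nil, by simp, by simp⟩
  | cons c l ih =>
    obtain ⟨p, h₁, h₂⟩ := ih (a := c) (fun e he => h e (by simp [he]))
    have hac : G.Adj a c := (SimpleGraph.mem_edgeSet G).1 (h s(a, c) (by simp))
    exact ⟨.cons hac p, by simp [h₁], by simp [← h₂]⟩

lemma IsCycleEdges.exists_isCycle {c : Multiset (Sym2 V)} (hc : IsCycleEdges c)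
    (h : ∀ e ∈ c, e ∈ G.edgeSet) :
    ∃ (a : V) (p : G.Walk a a), p.IsCycle ∧ (p.edges : Multiset (Sym2 V)) = c := by
  obtain ⟨a, l, hl, hlen, rfl⟩ := hc
  obtain ⟨b, l, rfl⟩ := List.exists_cons_of_length_pos (show 0 < l.length by omega)
  obtain ⟨d, l, rfl⟩ := List.exists_cons_of_length_pos (show 0 < l.length by simp at hlen; omega)
  obtain ⟨p, h₁, h₂⟩ := exists_walk_of_segEdges (G := G) (a := b) (l := d :: l) (b := a)
    (fun e he => h e (Multiset.mem_add.2 (Or.inr he)))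
  have hab : G.Adj a b := (SimpleGraph.mem_edgeSet G).1
    (h s(a, b) (Multiset.mem_add.2 (Or.inl (by simp))))
  refine ⟨a, .cons hab p, ?_, ?_⟩
  swap
  · rw [SimpleGraph.Walk.edges_cons, ← Multiset.cons_coe, h₂, segEdges_cons a,
      Multiset.singleton_add]
  rw [SimpleGraph.Walk.cons_isCycle_iff, SimpleGraph.Walk.isPath_def, h₁]
  constructor
  · simp [List.nodup_append] at *; grind
  · rw [← Multiset.mem_coe, h₂, segEdges_cons, Multiset.mem_add, Multiset.mem_singleton]
    rintro (H | H)
    · simp at H hl; grind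
    · have := touches_right H
      simp at this hl; grind

end Walks

section Translation

variable {V : Type} [Fintype V]

/-- The edges of `G` as a multiset. -/
noncomputable def edgeMultiset (G : SimpleGraph V) : Multiset (Sym2 V) :=
  (Set.toFinite G.edgeSet).toFinset.val

@[simp] lemma mem_edgeMultiset {G : SimpleGraph V} {e : Sym2 V} :
    e ∈ edgeMultiset G ↔ e ∈ G.edgeSet := by
  simp [edgeMultiset]

lemma nodup_edgeMultiset (G : SimpleGraph V) : (edgeMultiset G).Nodup :=
  Finset.nodup _

lemma sum_map_eq_bind {α β : Type*} (s : Multiset α) (f : α → Multiset β) :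
    (s.map f).sum = s.bind f := rfl

open scoped Function in
lemma disjoint_of_nodup_bind {α β : Type*} {s : Multiset α} {f : α → Multiset β}
    (h : (s.bind f).Nodup) {a b : α} (ha : a ∈ s) (hb : b ∈ s) (hab : a ≠ b) :
    Disjoint (f a) (f b) := by
  have : Std.Symm (Disjoint on f) := ⟨fun _ _ H => Disjoint.symm H⟩
  exact (Multiset.nodup_bind.1 h).2.forall ha hb hab

lemma fulfilsHajos_iff {G : SimpleGraph V} :
    FulfilsHajos G ↔ CycleDecomposable (edgeMultiset G) ((Fintype.card V - 1) / 2) := by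
  constructor
  · rintro ⟨m, B, c, hm, hc, hd, he⟩
    refine ⟨Finset.univ.val.map fun i => ((c i).edges : Multiset (Sym2 V)), ?_, ?_, by simpa⟩
    · intro d hd
      obtain ⟨i, -, rfl⟩ := Multiset.mem_map.1 hd
      exact isCycleEdges_of_isCycle (hc i)
    · rw [sum_map_eq_bind]
      refine (Multiset.Nodup.ext ?_ (nodup_edgeMultiset G)).2 ?_
      · rw [Multiset.nodup_bind]
        refine ⟨fun i _ => Multiset.coe_nodup.2 (hc i).edges_nodup, ?_⟩
        refine Multiset.Nodup.pairwise ?_ Finset.univ.nodup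
        intro i _ j _ hij
        exact Multiset.disjoint_left.2 fun {e} h₁ h₂ => hd i j hij e h₁ h₂
      · intro e
        simp [he]
  · rintro ⟨D, hD, hsum, hcard⟩
    have hmem : ∀ i : Fin D.toList.length, D.toList.get i ∈ D := fun i =>
      Multiset.mem_toList.1 (List.get_mem _ _)
    have hDf : D = (Finset.univ : Finset (Fin D.toList.length)).val.map D.toList.get := by
      rw [Fin.univ_val_map, List.ofFn_get, Multiset.coe_toList]
    have hbind : edgeMultiset G =
        (Finset.univ : Finset (Fin D.toList.length)).val.bind D.toList.get := by
      rw [← hsum]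
      conv_lhs => rw [hDf]
      rfl
    have hG : ∀ i, ∀ e ∈ D.toList.get i, e ∈ G.edgeSet := by
      intro i e he
      rw [← mem_edgeMultiset, hbind, Multiset.mem_bind]
      exact ⟨i, Finset.mem_univ_val i, he⟩
    choose B c hc hce using fun i => (hD _ (hmem i)).exists_isCycle (hG i)
    have hce' : ∀ i e, e ∈ (c i).edges ↔ e ∈ D.toList.get i := by
      intro i e
      rw [← Multiset.mem_coe, hce]
    refine ⟨D.toList.length, B, c, by simpa using hcard, hc, ?_, ?_⟩
    · intro i j hij e h₁ h₂
      rw [hce'] at h₁ h₂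
      have hnd := nodup_edgeMultiset G
      rw [hbind] at hnd
      exact Multiset.disjoint_left.1 (disjoint_of_nodup_bind hnd (Finset.mem_univ_val i)
        (Finset.mem_univ_val j) hij) h₁ h₂
    · intro e
      rw [← mem_edgeMultiset, hbind, Multiset.mem_bind]
      simp [hce']

end Translation

section Map

variable {V W : Type} {f : W → V}

lemma map_segEdges (f : W → V) (a b : W) (l : List W) :
    (segEdges a l b).map (Sym2.map f) = segEdges (f a) (l.map f) (f b) := by
  induction l generalizing a with
  | nil => simp
  | cons c l ih => simp [ih]

lemma IsCycleEdges.map (hf : f.Injective) {c : Multiset (Sym2 W)} (hc : IsCycleEdges c) :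
    IsCycleEdges (c.map (Sym2.map f)) := by
  obtain ⟨a, l, hl, hlen, rfl⟩ := hc
  exact ⟨f a, l.map f, by simpa using hl.map hf, by simpa using hlen, map_segEdges f a a l⟩

lemma CycleDecomposable.map (hf : f.Injective) {M : Multiset (Sym2 W)} {k : ℕ}
    (h : CycleDecomposable M k) : CycleDecomposable (M.map (Sym2.map f)) k := by
  obtain ⟨D, hD, rfl, hk⟩ := h
  refine ⟨D.map (Multiset.map (Sym2.map f)), ?_, ?_, by simpa⟩
  · intro c hc
    obtain ⟨d, hd, rfl⟩ := Multiset.mem_map.1 hc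
    exact (hD d hd).map hf
  · exact (map_multiset_sum (Multiset.mapAddMonoidHom (Sym2.map f)) D).symm

end Map

section Valency

variable {V W : Type}

open Classical in
/-- The number of edges of `M` at the vertex `x`. -/
noncomputable def valency (M : Multiset (Sym2 V)) (x : V) : ℕ := M.countP (x ∈ ·)

@[simp] lemma valency_add (M N : Multiset (Sym2 V)) (x : V) :
    valency (M + N) x = valency M x + valency N x := by
  simp [valency]

open Classical in
lemma valency_singleton (e : Sym2 V) (x : V) : valency {e} x = if x ∈ e then 1 else 0 := by
  rw [valency, ← Multiset.cons_zero, Multiset.countP_cons, Multiset.countP_zero, zero_add]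

lemma ncard_neighborSet_eq_valency {K : SimpleGraph W} {f : W → V} (hf : f.Injective)
    {M : Multiset (Sym2 V)} (hM : M.Nodup) (hadj : ∀ a b, K.Adj a b ↔ s(f a, f b) ∈ M)
    (hrange : ∀ e ∈ M, ∀ x ∈ e, x ∈ Set.range f) (x : W) :
    (K.neighborSet x).ncard = valency M (f x) := by
  classical
  have hinj : Function.Injective fun a => s(f x, f a) := fun a b h => hf (Sym2.congr_right.1 h)
  have himage : (fun a => s(f x, f a)) '' K.neighborSet x =
      ((M.filter (f x ∈ ·)).toFinset : Set (Sym2 V)) := by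
    ext e
    simp only [Set.mem_image, SimpleGraph.mem_neighborSet, hadj, Finset.mem_coe,
      Multiset.mem_toFinset, Multiset.mem_filter]
    constructor
    · rintro ⟨a, ha, rfl⟩
      exact ⟨ha, by simp⟩
    · rintro ⟨he, y, rfl⟩
      obtain ⟨b, rfl⟩ := hrange _ he y (by simp)
      exact ⟨b, he, rfl⟩
  rw [← Set.ncard_image_of_injective _ hinj, himage, Set.ncard_coe_finset,
    Multiset.toFinset_card_of_nodup (hM.filter _), valency, Multiset.countP_eq_card_filter]

end Valency

section Decomposition

variable {V : Type}

lemma cycleDecomposable_of_fulfilsHajos {S : Finset V} {M : Multiset (Sym2 V)} (hM : M.Nodup)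
    (hS : ∀ e ∈ M, ∀ x ∈ e, x ∈ S) {K : SimpleGraph S}
    (hadj : ∀ a b : S, K.Adj a b ↔ s((a : V), (b : V)) ∈ M) (hK : FulfilsHajos K) :
    CycleDecomposable M ((S.card - 1) / 2) := by
  have h := (fulfilsHajos_iff.1 hK).map (f := Subtype.val) Subtype.val_injective
  rw [Fintype.card_coe] at h
  convert h using 1
  refine (Multiset.Nodup.ext hM
    ((nodup_edgeMultiset K).map (Sym2.map.injective Subtype.val_injective))).2 fun e => ?_
  rw [Multiset.mem_map]
  constructor
  · intro he
    induction e with | _ a b =>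
    refine ⟨s(⟨a, hS _ he a (by simp)⟩, ⟨b, hS _ he b (by simp)⟩), ?_, rfl⟩
    simpa [hadj] using he
  · rintro ⟨e, he, rfl⟩
    induction e with | _ a b =>
    simpa [hadj] using he

/-- If the smaller Eulerian graphs fulfil Hajós' conjecture, then an even edge set on the vertex
set `S`, connected or not, decomposes into at most `(|S| - 1) / 2` cycles. -/
lemma cycleDecomposable_of_even {n : ℕ}
    (hmin : ∀ (W : Type) [Fintype W] (K : SimpleGraph W), IsEulerian K → Fintype.card W < n →
      FulfilsHajos K)
    {S : Finset V} (hSn : S.card < n) {M : Multiset (Sym2 V)} (hM : M.Nodup)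
    (hdiag : ∀ e ∈ M, ¬ e.IsDiag) (heven : ∀ x, Even (valency M x))
    (hS : ∀ e ∈ M, ∀ x ∈ e, x ∈ S) : CycleDecomposable M ((S.card - 1) / 2) := by
  classical
  induction hs : S.card using Nat.strong_induction_on generalizing S M with
  | _ s ih =>
  subst hs
  obtain rfl | ⟨a, ha⟩ := S.eq_empty_or_nonempty
  · have : M = 0 := by
      refine Multiset.eq_zero_of_forall_notMem fun e he => ?_
      induction e with | _ x y => simpa using hS _ he x (by simp)
    exact ⟨0, by simp, by simp [this], by simp⟩
  let r : V → V → Prop := fun x y => s(x, y) ∈ M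
  let A := S.filter (Relation.ReflTransGen r a)
  have haA : a ∈ A := Finset.mem_filter.2 ⟨ha, .refl⟩
  by_cases hA : A = S
  · let K : SimpleGraph S :=
      { Adj := fun b c => s((b : V), (c : V)) ∈ M
        symm := ⟨fun b c h => by rwa [Sym2.eq_swap]⟩
        loopless := ⟨fun b h => hdiag _ h (by simp)⟩ }
    refine cycleDecomposable_of_fulfilsHajos hM hS (K := K) (fun _ _ => Iff.rfl)
      (hmin S K ⟨?_, fun x => ?_⟩ (by simpa))
    · have hreach : ∀ b, Relation.ReflTransGen r a b →
          ∃ hb : b ∈ S, K.Reachable ⟨a, ha⟩ ⟨b, hb⟩ := by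
        intro b hb
        induction hb with
        | refl => exact ⟨ha, .refl _⟩
        | @tail b c _ hbc ih =>
          obtain ⟨hb, h⟩ := ih
          have hc : c ∈ S := hS _ hbc c (by simp)
          have hadj : K.Adj ⟨b, hb⟩ ⟨c, hc⟩ := hbc
          exact ⟨hc, h.trans hadj.reachable⟩
      have hall : ∀ b : S, K.Reachable ⟨a, ha⟩ b := fun b =>
        (hreach b (Finset.mem_filter.1 (hA.symm.subset b.2)).2).2
      exact { preconnected := fun b c => (hall b).symm.trans (hall c), nonempty := ⟨⟨a, ha⟩⟩ }
    · rw [ncard_neighborSet_eq_valency (K := K) (f := Subtype.val) Subtype.val_injective hM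
        (fun _ _ => Iff.rfl) (fun e he y hy => ⟨⟨y, hS e he y hy⟩, rfl⟩)]
      exact heven x
  · have hAS : A ⊆ S := Finset.filter_subset _ _
    have hlt : A.card < S.card := Finset.card_lt_card (hAS.ssubset_of_ne hA)
    have hpos : 0 < A.card := Finset.card_pos.2 ⟨a, haA⟩
    have hsdiff : (S \ A).card = S.card - A.card := Finset.card_sdiff_of_subset hAS
    have hclosed : ∀ e ∈ M, ∀ x ∈ e, ∀ y ∈ e, x ∈ A → y ∈ A := by
      intro e he x hx y hy hxA
      by_cases hxy : x = y
      · rwa [← hxy]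
      · rw [(Sym2.mem_and_mem_iff hxy).1 ⟨hx, hy⟩] at he
        exact Finset.mem_filter.2 ⟨hS _ he y (by simp), (Finset.mem_filter.1 hxA).2.tail he⟩
    let P : Sym2 V → Prop := fun e => ∃ x ∈ e, x ∈ A
    have hsplit : M.filter P + M.filter (¬ P ·) = M := Multiset.filter_add_not P M
    have hval : ∀ x, valency (M.filter P) x + valency (M.filter (¬ P ·)) x = valency M x := by
      intro x
      rw [← valency_add, hsplit]
    have hzero : ∀ x, valency (M.filter P) x = 0 ∨ valency (M.filter (¬ P ·)) x = 0 := by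
      intro x
      by_cases hx : x ∈ A
      · right
        rw [valency, Multiset.countP_eq_zero]
        intro e he hxe
        exact (Multiset.mem_filter.1 he).2 ⟨x, hxe, hx⟩
      · left
        rw [valency, Multiset.countP_eq_zero]
        intro e he hxe
        obtain ⟨he, y, hy, hyA⟩ := Multiset.mem_filter.1 he
        exact hx (hclosed e he y hy x hxe hyA)
    have h₁ := ih _ hlt (S := A) (M := M.filter P) (by omega) (hM.filter _)
      (fun e he => hdiag e (Multiset.mem_of_mem_filter he))
      (fun x => by
        have := heven x
        rcases hzero x with h | h
        · rw [h]; exact Even.zero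
        · rwa [← hval, h, add_zero] at this)
      (fun e he x hx => by
        obtain ⟨he, y, hy, hyA⟩ := Multiset.mem_filter.1 he
        exact hclosed e he y hy x hx hyA) rfl
    have h₂ := ih _ (by omega) (S := S \ A) (M := M.filter (¬ P ·)) (by omega) (hM.filter _)
      (fun e he => hdiag e (Multiset.mem_of_mem_filter he))
      (fun x => by
        have := heven x
        rcases hzero x with h | h
        · rwa [← hval, h, zero_add] at this
        · rw [h]; exact Even.zero)
      (fun e he x hx => by
        obtain ⟨he, hP⟩ := Multiset.mem_filter.1 he
        exact Finset.mem_sdiff.2 ⟨hS e he x hx, fun hxA => hP ⟨x, hx, hxA⟩⟩) rfl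
    rw [← hsplit]
    exact (h₁.add h₂).mono (by omega)

end Decomposition

section Main

variable {V : Type}

lemma valency_triangle {x y z : V} (hxy : x ≠ y) (hxz : x ≠ z) (hyz : y ≠ z) (a : V) :
    Even (valency ({s(x, y)} + {s(y, z)} + {s(z, x)}) a) := by
  classical
  simp only [valency_add, valency_singleton, Sym2.mem_iff]
  split_ifs <;> first | decide | grind

open Classical in
lemma valency_map_star {u : V} {N : Finset V} (a : V) :
    valency (N.val.map fun x => s(u, x)) a =
      if a = u then N.card else if a ∈ N then 1 else 0 := by
  rw [valency, Multiset.countP_map]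
  split_ifs with h h'
  · simp [h]
  · have : N.val.filter (fun x => a ∈ s(u, x)) = {a} := by
      refine (Multiset.Nodup.ext (N.nodup.filter _) (Multiset.nodup_singleton a)).2 fun b => ?_
      simp [h]
      grind
    rw [this, Multiset.card_singleton]
  · rw [Multiset.card_eq_zero, Multiset.filter_eq_nil]
    simp [h]
    grind

lemma even_valency_hub {u v : V} {N : Finset V} (huv : u ≠ v) (hu : u ∉ N) (hv : v ∉ N)
    (hN : N.card = 5) (a : V) : Even (valency (hub u v N) a) := by
  classical
  rw [hub, valency_add, valency_add, valency_map_star, valency_map_star,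
    valency_singleton, hN]
  simp only [Sym2.mem_iff]
  split_ifs <;> first | decide | grind

lemma neighborSet_eq_insert [Finite V] {G : SimpleGraph V} {u v : V} {T : Set V} (huv : G.Adj u v)
    (hT : T ⊆ G.neighborSet u) (hv : v ∉ T) (h : (G.neighborSet u).ncard = T.ncard + 1) :
    G.neighborSet u = insert v T := by
  have huv' : v ∈ G.neighborSet u := huv
  refine (Set.eq_of_subset_of_ncard_le (Set.insert_subset huv' hT) ?_ (Set.toFinite _)).symm
  rw [h, Set.ncard_insert_of_notMem hv (Set.toFinite _)]

lemma nodup_hub {u v : V} {N : Finset V} (huv : u ≠ v) (hu : u ∉ N) (hv : v ∉ N) :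
    (hub u v N).Nodup := by
  rw [hub, Multiset.nodup_add, Multiset.nodup_add]
  refine ⟨⟨Multiset.nodup_singleton _, N.nodup.map fun a b h => Sym2.congr_right.1 h, ?_⟩,
    N.nodup.map fun a b h => Sym2.congr_right.1 h, ?_⟩ <;>
  · rw [Multiset.disjoint_left]
    simp
    grind

lemma mem_hub {u v : V} {N : Finset V} {e : Sym2 V} :
    e ∈ hub u v N ↔ e = s(u, v) ∨ (∃ x ∈ N, s(u, x) = e) ∨ ∃ x ∈ N, s(v, x) = e := by
  simp [hub]

end Main

/-- In a minimum counterexample, if two adjacent degree-6 vertices `u` and `v` satisfy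
`|N(u) ∩ N(v)| = 5`, then `G - {u, v}` contains no vertex with at least three
neighbours in `N(u) ∩ N(v)`. -/
theorem minCounterexample_common_five_no_claw {V : Type} [Fintype V]
    (G : SimpleGraph V) (hG : IsMinCounterexample G)
    (u v : V) (huv : G.Adj u v)
    (hdu : (G.neighborSet u).ncard = 6) (hdv : (G.neighborSet v).ncard = 6)
    (hcap : (G.neighborSet u ∩ G.neighborSet v).ncard = 5) :
    ∀ w : V, w ≠ u → w ≠ v →
      ¬ (3 ≤ ({x ∈ G.neighborSet u ∩ G.neighborSet v | G.Adj w x}).ncard) := by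
  classical
  intro w hwu hwv hw
  have hmin : ∀ (W : Type) [Fintype W] (K : SimpleGraph W), IsEulerian K →
      Fintype.card W < Fintype.card V → FulfilsHajos K := fun W _ K hK hlt => by
    by_contra h
    exact absurd (hG.2.1 W K ⟨hK, h⟩) (by omega)
  obtain ⟨N, hN⟩ : ∃ N : Finset V, (N : Set V) = G.neighborSet u ∩ G.neighborSet v :=
    ⟨(Set.toFinite _).toFinset, Set.Finite.coe_toFinset _⟩
  have hmemN : ∀ a, a ∈ N ↔ G.Adj u a ∧ G.Adj v a := fun a => by
    rw [← Finset.mem_coe, hN]; rfl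
  have huN : u ∉ N := fun h => G.loopless.irrefl u ((hmemN u).1 h).1
  have hvN : v ∉ N := fun h => G.loopless.irrefl v ((hmemN v).1 h).2
  have hcard : N.card = 5 := by rw [← Set.ncard_coe_finset, hN, hcap]
  have hu : ∀ a, G.Adj u a ↔ a = v ∨ a ∈ N := fun a => by
    have := neighborSet_eq_insert huv (T := N) (hN ▸ Set.inter_subset_left) (by simpa using hvN)
      (by rw [hN, hcap, hdu])
    rw [← SimpleGraph.mem_neighborSet, this]
    simp
  have hv : ∀ a, G.Adj v a ↔ a = u ∨ a ∈ N := fun a => by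
    have := neighborSet_eq_insert huv.symm (T := N) (hN ▸ Set.inter_subset_right)
      (by simpa using huN) (by rw [hN, hcap, hdv])
    rw [← SimpleGraph.mem_neighborSet, this]
    simp
  let E := (edgeMultiset G).filter fun e => u ∉ e ∧ v ∉ e
  have hE : E.Nodup := (nodup_edgeMultiset G).filter _
  have hmemE : ∀ a b, s(a, b) ∈ E ↔ G.Adj a b ∧ a ≠ u ∧ a ≠ v ∧ b ≠ u ∧ b ≠ v := fun a b => by
    simp [E]
    grind
  have hEu : ¬ Touches u E := fun ⟨e, he, hue⟩ => (Multiset.mem_filter.1 he).2.1 hue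
  have hEv : ¬ Touches v E := fun ⟨e, he, hve⟩ => (Multiset.mem_filter.1 he).2.2 hve
  have hsplit : edgeMultiset G = E + hub u v N := by
    refine (Multiset.Nodup.ext (nodup_edgeMultiset G) ?_).2 fun e => ?_
    · refine Multiset.nodup_add.2 ⟨hE, nodup_hub huv.ne huN hvN, ?_⟩
      refine Multiset.disjoint_left.2 fun {e} he h => ?_
      have := (Multiset.mem_filter.1 he).2
      rcases mem_hub.1 h with rfl | ⟨x, -, rfl⟩ | ⟨x, -, rfl⟩ <;> simp at this
    · induction e with | _ a b =>
      rw [Multiset.mem_add, hmemE, mem_hub, mem_edgeMultiset, SimpleGraph.mem_edgeSet]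
      have h₁ := hu a
      have h₂ := hu b
      have h₃ := hv a
      have h₄ := hv b
      have h₅ := G.adj_comm a b
      simp only [Sym2.eq_iff]
      grind
  have hval : ∀ a, valency (edgeMultiset G) a = (G.neighborSet a).ncard := fun a =>
    (ncard_neighborSet_eq_valency (f := id) Function.injective_id (nodup_edgeMultiset G)
      (by simp) (by simp) a).symm
  have hEeven : ∀ a, Even (valency E a) := fun a => by
    have h := hG.1.1.2 a
    rw [← hval, hsplit, valency_add, Nat.even_add] at h
    exact h.2 (even_valency_hub huv.ne huN hvN hcard a)
  let S : Finset V := Finset.univ \ {u, v}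
  have hSmem : ∀ a, a ∈ S ↔ a ≠ u ∧ a ≠ v := fun a => by simp [S]
  have hScard : S.card = Fintype.card V - 2 := by
    rw [Finset.card_sdiff_of_subset (Finset.subset_univ _), Finset.card_univ,
      Finset.card_pair huv.ne]
  have hVcard : 7 ≤ Fintype.card V := by
    rw [← Finset.card_univ]
    have h : (insert u (insert v N)).card = 7 := by
      rw [Finset.card_insert_of_notMem (by simp [huv.ne, huN]), Finset.card_insert_of_notMem hvN,
        hcard]
    exact h ▸ Finset.card_le_univ _
  have hES : ∀ e ∈ E, ∀ x ∈ e, x ∈ S := fun e he x hx => by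
    have := (Multiset.mem_filter.1 he).2
    rw [hSmem]
    exact ⟨fun h => this.1 (h ▸ hx), fun h => this.2 (h ▸ hx)⟩
  have hEdiag : ∀ e ∈ E, ¬ e.IsDiag := fun e he =>
    G.not_isDiag_of_mem_edgeSet (mem_edgeMultiset.1 (Multiset.mem_of_mem_filter he))
  have hNS : ∀ x ∈ N, x ∈ S := fun x hx => (hSmem x).2
    ⟨fun h => huN (h ▸ hx), fun h => hvN (h ▸ hx)⟩
  obtain ⟨x, hx, y, hy, z, hz, hxy, hxz, hyz⟩ := (Set.two_lt_ncard (Set.toFinite _)).1 hw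
  have hwE : ∀ x ∈ {x ∈ G.neighborSet u ∩ G.neighborSet v | G.Adj w x}, x ∈ N ∧ s(w, x) ∈ E :=
    fun x hx => ⟨(hmemN x).2 hx.1, (hmemE w x).2 ⟨hx.2, hwu, hwv, hx.1.1.ne', hx.1.2.ne'⟩⟩
  have hmain := cycleDecomposable_add_hub huv.ne hcard huN hvN hE hEu hEv
    (cycleDecomposable_of_even hmin (by omega) hE hEdiag hEeven hES) ?_
    (hwE x hx).1 (hwE y hy).1 (hwE z hz).1 hxy hxz hyz hx.2.ne' (hwE x hx).2 (hwE y hy).2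
    (hwE z hz).2
  · refine hG.1.2 (fulfilsHajos_iff.2 ?_)
    rw [hsplit]
    exact hmain.mono (by omega)
  · intro a ha b hb c hc hab hac hbc hab' hbc' hac'
    refine cycleDecomposable_of_even hmin (by omega) ?_ ?_ ?_ ?_
    · simp only [Multiset.nodup_add, Multiset.nodup_singleton, Multiset.disjoint_left,
        Multiset.mem_add, Multiset.mem_singleton]
      rw [Sym2.eq_swap] at hac'
      simp [hE]
      grind
    · simp only [Multiset.mem_add, Multiset.mem_singleton]
      rintro e (((rfl | rfl) | rfl) | he)
      exacts [by simpa, by simpa, by simpa using hac.symm, hEdiag e he]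
    · intro d
      rw [valency_add]
      exact (valency_triangle hab hac hbc d).add (hEeven d)
    · simp only [Multiset.mem_add, Multiset.mem_singleton]
      have := hNS a ha
      have := hNS b hb
      have := hNS c hc
      rintro e (((rfl | rfl) | rfl) | he) d hd
      · rcases Sym2.mem_iff.1 hd with rfl | rfl <;> assumption
      · rcases Sym2.mem_iff.1 hd with rfl | rfl <;> assumption
      · rcases Sym2.mem_iff.1 hd with rfl | rfl <;> assumption
      · exact hES e he d hd
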